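/- arXiv:1905.00362 — 2 statements merged into one kernel-verified Lean document; each statement's English description precedes it below -/
import Mathlib

section
/- Let v : [−1,1] → ℝ be twice continuously differentiable and let n ≥ 2 be an integer. Then the n-th Fourier–Legendre coefficient of v satisfies |v_n| ≤ 4√2 · ‖v''‖ / (2n − 3)^{3/2}. -/
open MeasureTheory

/-- The `n`-th Legendre polynomial via Rodrigues' formula
`P_n(x) = (1/(2^n n!)) dⁿ/dxⁿ (x²−1)ⁿ`. -/
noncomputable def legendreP (n : ℕ) (x : ℝ) : ℝ :=
  (1 / (2 ^ n * (Nat.factorial n : ℝ))) * iteratedDeriv n (fun y : ℝ => (y ^ 2 - 1) ^ n) x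

/-- The `n`-th Fourier–Legendre coefficient `f_n = ((2n+1)/2) ∫_{−1}^1 f(x) P_n(x) dx`. -/
noncomputable def flCoeff (f : ℝ → ℝ) (n : ℕ) : ℝ :=
  ((2 * (n : ℝ) + 1) / 2) * ∫ x in (-1 : ℝ)..1, f x * legendreP n x

/-- The L² norm of a function on `(−1,1)`: `‖g‖ = (∫_{−1}^1 g(x)² dx)^{1/2}`. -/
noncomputable def L2norm (g : ℝ → ℝ) : ℝ :=
  Real.sqrt (∫ x in (-1 : ℝ)..1, g x ^ 2)

open Polynomial in
/-- The `k`-th derivative of `(X² - 1)ⁿ`. -/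
noncomputable def rodriguesDeriv (n k : ℕ) : ℝ[X] :=
  derivative^[k] ((X ^ 2 - 1) ^ n)

theorem derivative_rodriguesDeriv (n k : ℕ) :
    (rodriguesDeriv n k).derivative = rodriguesDeriv n (k + 1) := by
  simp only [rodriguesDeriv, Function.iterate_succ_apply']

theorem iteratedDeriv_eval_eq (p : Polynomial ℝ) (k : ℕ) :
    iteratedDeriv k (fun x => p.eval x) = fun x => (Polynomial.derivative^[k] p).eval x := by
  induction k with
  | zero => simp
  | succ k ih =>
    rw [iteratedDeriv_succ, ih]
    funext x
    rw [Polynomial.deriv, Function.iterate_succ_apply']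

theorem legendreP_eq_rodriguesDeriv (n : ℕ) (x : ℝ) :
    legendreP n x = 1 / (2 ^ n * (n.factorial : ℝ)) * (rodriguesDeriv n n).eval x := by
  have h : (fun y : ℝ => (y ^ 2 - 1) ^ n) =
      fun y => (((Polynomial.X ^ 2 - 1) ^ n : Polynomial ℝ)).eval y := by
    funext y
    simp
  rw [legendreP, h, iteratedDeriv_eval_eq, rodriguesDeriv]

theorem eval_rodriguesDeriv_eq_zero {n k : ℕ} (hk : k < n) {x : ℝ} (hx : x ^ 2 = 1) :
    (rodriguesDeriv n k).eval x = 0 := by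
  obtain ⟨q, hq⟩ := Polynomial.pow_sub_dvd_iterate_derivative_pow
    (Polynomial.X ^ 2 - 1 : Polynomial ℝ) n k
  have : n - k ≠ 0 := by omega
  rw [rodriguesDeriv, hq]
  simp [hx, this]

open Polynomial in
theorem rodriguesDeriv_recurrence (n m : ℕ) :
    (X ^ 2 - 1) * rodriguesDeriv n (m + 2) =
      2 * ((n : ℝ[X]) - (m : ℝ[X]) - 1) * X * rodriguesDeriv n (m + 1) +
        ((m : ℝ[X]) + 1) * (2 * (n : ℝ[X]) - (m : ℝ[X])) * rodriguesDeriv n m := by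
  induction m with
  | zero =>
    have h : (X ^ 2 - 1) * rodriguesDeriv n 1 = 2 * (n : ℝ[X]) * X * rodriguesDeriv n 0 := by
      cases n with
      | zero => simp [rodriguesDeriv]
      | succ n =>
        simp [rodriguesDeriv, derivative_pow, ← C_ofNat]
        ring
    have h' := congrArg derivative h
    simp only [derivative_mul, derivative_rodriguesDeriv, derivative_sub, derivative_X_pow,
      derivative_X, derivative_natCast, derivative_ofNat, derivative_one, map_natCast] at h'
    push_cast at h' ⊢
    linear_combination h'
  | succ m ih =>
    have h' := congrArg derivative ih
    simp only [derivative_mul, derivative_rodriguesDeriv, derivative_sub, derivative_add,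
      derivative_X_pow, derivative_X, derivative_natCast, derivative_ofNat, derivative_one,
      map_natCast] at h'
    push_cast at h' ⊢
    linear_combination h'

open Polynomial in
theorem sq_mul_rodriguesDeriv (k : ℕ) :
    (X ^ 2 - 1) ^ 2 * rodriguesDeriv (k + 2) (k + 4) =
      ((k : ℝ[X]) + 1) * ((k : ℝ[X]) + 2) * ((k : ℝ[X]) + 3) * ((k : ℝ[X]) + 4) *
        rodriguesDeriv (k + 2) k := by
  have h0 := rodriguesDeriv_recurrence (k + 2) k
  have h1 := rodriguesDeriv_recurrence (k + 2) (k + 1)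
  have h2 := rodriguesDeriv_recurrence (k + 2) (k + 2)
  push_cast at h0 h1 h2
  linear_combination (X ^ 2 - 1) * h2 - 2 * X * h1 + ((k : ℝ[X]) + 2) * ((k : ℝ[X]) + 3) * h0

theorem rodriguesDeriv_two_mul (n : ℕ) :
    rodriguesDeriv n (2 * n) = Polynomial.C ((2 * n).factorial : ℝ) := by
  have hmonic : (Polynomial.X ^ 2 - 1 : Polynomial ℝ).Monic := by monicity!
  have hdeg : (Polynomial.X ^ 2 - 1 : Polynomial ℝ).natDegree = 2 := by compute_degree!
  have hdeg' : ((Polynomial.X ^ 2 - 1 : Polynomial ℝ) ^ n).natDegree = 2 * n := by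
    rw [hmonic.natDegree_pow, hdeg, mul_comm]
  have hle := Polynomial.natDegree_iterate_derivative
    ((Polynomial.X ^ 2 - 1 : Polynomial ℝ) ^ n) (2 * n)
  rw [hdeg', Nat.sub_self, Nat.le_zero] at hle
  have hlead := (hmonic.pow n).coeff_natDegree
  rw [hdeg'] at hlead
  rw [rodriguesDeriv, Polynomial.eq_C_of_natDegree_eq_zero hle,
    Polynomial.coeff_iterate_derivative, zero_add, hlead, Nat.descFactorial_self]
  simp

/-- Integration by parts on `[-1, 1]` against a polynomial that vanishes at the endpoints. -/
theorem integral_mul_eval_derivative {u u' : ℝ → ℝ} {p : Polynomial ℝ}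
    (hu : ∀ x ∈ Set.Icc (-1 : ℝ) 1, HasDerivWithinAt u (u' x) (Set.Icc (-1) 1) x)
    (hu' : ContinuousOn u' (Set.Icc (-1) 1)) (hp : p.eval 1 = 0) (hp' : p.eval (-1) = 0) :
    ∫ x in (-1 : ℝ)..1, u x * p.derivative.eval x = -∫ x in (-1 : ℝ)..1, u' x * p.eval x := by
  have hI : Set.uIcc (-1 : ℝ) 1 = Set.Icc (-1) 1 := Set.uIcc_of_le (by norm_num)
  rw [intervalIntegral.integral_mul_deriv_eq_deriv_mul_of_hasDerivWithinAt (u := u) (u' := u')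
    (v := fun x => p.eval x) (v' := fun x => p.derivative.eval x)]
  · simp [hp, hp']
  · rwa [hI]
  · exact fun x _ => (p.hasDerivAt x).hasDerivWithinAt
  · exact (hI ▸ hu').intervalIntegrable
  · exact p.derivative.continuous.intervalIntegrable _ _

/-- Repeated integration by parts on `[-1, 1]` for a product of derivatives of `(x² - 1)ⁿ`. -/
theorem integral_rodriguesDeriv_mul {n k : ℕ} (hk : k ≤ n) :
    ∫ x in (-1 : ℝ)..1, (rodriguesDeriv n n).eval x * (rodriguesDeriv n n).eval x =
      (-1) ^ k * ∫ x in (-1 : ℝ)..1,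
        (rodriguesDeriv n (n + k)).eval x * (rodriguesDeriv n (n - k)).eval x := by
  induction k with
  | zero => simp
  | succ k ih =>
    have hlt : n - (k + 1) < n := by omega
    have hs : n - k = n - (k + 1) + 1 := by omega
    rw [ih (by omega), hs, ← derivative_rodriguesDeriv,
      integral_mul_eval_derivative
        (fun x _ => ((rodriguesDeriv n (n + k)).hasDerivAt x).hasDerivWithinAt)
        (Polynomial.continuous _).continuousOn
        (eval_rodriguesDeriv_eq_zero hlt (by norm_num))
        (eval_rodriguesDeriv_eq_zero hlt (by norm_num)),
      derivative_rodriguesDeriv, pow_succ, ← add_assoc]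
    ring

theorem integral_one_sub_sq_pow (n : ℕ) :
    (∫ x in (-1 : ℝ)..1, (1 - x ^ 2) ^ n) * ((2 * n + 1).factorial : ℝ) =
      2 * (2 ^ n * (n.factorial : ℝ)) ^ 2 := by
  induction n with
  | zero => norm_num
  | succ n ih =>
    have hrec : (2 * (n : ℝ) + 3) * (∫ x in (-1 : ℝ)..1, (1 - x ^ 2) ^ (n + 1)) =
        2 * (n + 1) * ∫ x in (-1 : ℝ)..1, (1 - x ^ 2) ^ n := by
      have hderiv : ∀ x ∈ Set.uIcc (-1 : ℝ) 1, HasDerivAt (fun x : ℝ => x * (1 - x ^ 2) ^ (n + 1))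
          ((2 * (n : ℝ) + 3) * (1 - x ^ 2) ^ (n + 1) - 2 * (n + 1) * (1 - x ^ 2) ^ n) x := by
        intro x _
        have h := (hasDerivAt_id x).mul ((((hasDerivAt_id x).pow 2).const_sub 1).pow (n + 1))
        refine h.congr_deriv ?_
        simp
        ring
      have h := intervalIntegral.integral_eq_sub_of_hasDerivAt hderiv
        (Continuous.intervalIntegrable (by fun_prop) _ _)
      rw [intervalIntegral.integral_sub (Continuous.intervalIntegrable (by fun_prop) _ _)
        (Continuous.intervalIntegrable (by fun_prop) _ _), intervalIntegral.integral_const_mul,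
        intervalIntegral.integral_const_mul] at h
      norm_num at h
      linarith
    have hf : ((2 * (n + 1) + 1).factorial : ℝ) =
        (2 * n + 3) * (2 * n + 2) * ((2 * n + 1).factorial : ℝ) := by
      rw [show 2 * (n + 1) + 1 = 2 * n + 1 + 1 + 1 by ring, Nat.factorial_succ, Nat.factorial_succ]
      push_cast
      ring
    rw [hf, Nat.factorial_succ n]
    push_cast
    linear_combination (2 * (n : ℝ) + 2) * ((2 * n + 1).factorial : ℝ) * hrec +
      4 * ((n : ℝ) + 1) ^ 2 * ih

theorem integral_rodriguesDeriv_sq (n : ℕ) :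
    ∫ x in (-1 : ℝ)..1, (rodriguesDeriv n n).eval x * (rodriguesDeriv n n).eval x =
      2 * (2 ^ n * (n.factorial : ℝ)) ^ 2 / (2 * n + 1) := by
  have h := integral_one_sub_sq_pow n
  rw [Nat.factorial_succ] at h
  push_cast at h
  rw [integral_rodriguesDeriv_mul le_rfl, ← two_mul, rodriguesDeriv_two_mul, Nat.sub_self,
    eq_div_iff (by positivity), ← h, ← intervalIntegral.integral_const_mul]
  have hfun : ∀ x : ℝ, (-1) ^ n * ((Polynomial.C ((2 * n).factorial : ℝ)).eval x *
      (rodriguesDeriv n 0).eval x) = ((2 * n).factorial : ℝ) * (1 - x ^ 2) ^ n := by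
    intro x
    have hneg : (1 - x ^ 2) ^ n = (-1) ^ n * (x ^ 2 - 1) ^ n := by rw [← neg_sub, neg_pow]
    simp only [hneg, rodriguesDeriv, Function.iterate_zero, id_eq, Polynomial.eval_C,
      Polynomial.eval_pow, Polynomial.eval_sub, Polynomial.eval_X, Polynomial.eval_one]
    ring
  simp_rw [hfun, intervalIntegral.integral_const_mul]
  ring

/-- Moving two derivatives off a derivative of `(x² - 1)ⁿ` on `[-1, 1]`. -/
theorem integral_mul_rodriguesDeriv {u u' u'' : ℝ → ℝ} {k : ℕ}
    (hu : ∀ x ∈ Set.Icc (-1 : ℝ) 1, HasDerivWithinAt u (u' x) (Set.Icc (-1) 1) x)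
    (hu' : ∀ x ∈ Set.Icc (-1 : ℝ) 1, HasDerivWithinAt u' (u'' x) (Set.Icc (-1) 1) x)
    (hu'' : ContinuousOn u'' (Set.Icc (-1) 1)) :
    ∫ x in (-1 : ℝ)..1, u x * (rodriguesDeriv (k + 2) (k + 2)).eval x =
      ∫ x in (-1 : ℝ)..1, u'' x * (rodriguesDeriv (k + 2) k).eval x := by
  rw [← derivative_rodriguesDeriv, integral_mul_eval_derivative hu
      (fun x hx => (hu' x hx).continuousWithinAt)
      (eval_rodriguesDeriv_eq_zero (by omega) (by norm_num))
      (eval_rodriguesDeriv_eq_zero (by omega) (by norm_num)),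
    ← derivative_rodriguesDeriv, integral_mul_eval_derivative hu' hu''
      (eval_rodriguesDeriv_eq_zero (by omega) (by norm_num))
      (eval_rodriguesDeriv_eq_zero (by omega) (by norm_num)), neg_neg]

theorem integral_rodriguesDeriv_sub_two_sq_le (k : ℕ) :
    ∫ x in (-1 : ℝ)..1, (rodriguesDeriv (k + 2) k).eval x ^ 2 ≤
      2 * (2 ^ (k + 2) * ((k + 2).factorial : ℝ)) ^ 2 /
        ((2 * k + 5) * ((k + 1) * (k + 2) * (k + 3) * (k + 4))) := by
  set N : ℝ := (k + 1) * (k + 2) * (k + 3) * (k + 4) with hN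
  have hNpos : 0 < N := by positivity
  have hparts := integral_mul_rodriguesDeriv (k := k)
    (fun x _ => ((rodriguesDeriv (k + 2) (k + 2)).hasDerivAt x).hasDerivWithinAt)
    (fun x _ => ((rodriguesDeriv (k + 2) (k + 2)).derivative.hasDerivAt x).hasDerivWithinAt)
    (Polynomial.continuous _).continuousOn
  rw [derivative_rodriguesDeriv, derivative_rodriguesDeriv, integral_rodriguesDeriv_sq] at hparts
  have hle : ∫ x in (-1 : ℝ)..1, N * (rodriguesDeriv (k + 2) k).eval x ^ 2 ≤
      ∫ x in (-1 : ℝ)..1,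
        (rodriguesDeriv (k + 2) (k + 4)).eval x * (rodriguesDeriv (k + 2) k).eval x := by
    refine intervalIntegral.integral_mono_on (by norm_num)
      (Continuous.intervalIntegrable (by fun_prop) _ _)
      (Continuous.intervalIntegrable (by fun_prop) _ _) fun x hx => ?_
    have hode := congrArg (Polynomial.eval x) (sq_mul_rodriguesDeriv k)
    simp only [Polynomial.eval_mul, Polynomial.eval_pow, Polynomial.eval_sub, Polynomial.eval_X,
      Polynomial.eval_one, Polynomial.eval_add, Polynomial.eval_natCast,
      Polynomial.eval_ofNat] at hode
    rw [← hN] at hode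
    set a := (rodriguesDeriv (k + 2) (k + 4)).eval x
    set b := (rodriguesDeriv (k + 2) k).eval x
    have hx2 : (x ^ 2 - 1) ^ 2 ≤ 1 := by
      have : x ^ 2 ≤ 1 := by nlinarith [hx.1, hx.2]
      nlinarith [sq_nonneg x]
    have hab : N * (a * b) = (x ^ 2 - 1) ^ 2 * a ^ 2 := by linear_combination (-a) * hode
    have hbb : N * (N * b ^ 2) = ((x ^ 2 - 1) ^ 2) * ((x ^ 2 - 1) ^ 2 * a ^ 2) := by
      linear_combination (-(N * b) - (x ^ 2 - 1) ^ 2 * a) * hode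
    refine le_of_mul_le_mul_left ?_ hNpos
    rw [hab, hbb]
    exact mul_le_of_le_one_left (by positivity) hx2
  rw [intervalIntegral.integral_const_mul] at hle
  rw [← div_div, le_div_iff₀ hNpos, mul_comm]
  refine (hle.trans_eq hparts.symm).trans_eq ?_
  push_cast
  ring

theorem abs_integral_mul_le_sqrt_mul_sqrt {f g : ℝ → ℝ} {a b : ℝ} (hab : a ≤ b)
    (hf : ContinuousOn f (Set.uIcc a b)) (hg : ContinuousOn g (Set.uIcc a b)) :
    |∫ x in a..b, f x * g x| ≤ √(∫ x in a..b, f x ^ 2) * √(∫ x in a..b, g x ^ 2) := by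
  have hf2 : 0 ≤ ∫ x in a..b, f x ^ 2 :=
    intervalIntegral.integral_nonneg hab fun x _ => sq_nonneg _
  have hquad : ∀ t : ℝ, 0 ≤ (∫ x in a..b, g x ^ 2) * (t * t) +
      (2 * ∫ x in a..b, f x * g x) * t + ∫ x in a..b, f x ^ 2 := by
    intro t
    have h : 0 ≤ ∫ x in a..b, (f x + t * g x) ^ 2 :=
      intervalIntegral.integral_nonneg hab fun x _ => sq_nonneg _
    have hexp : ∀ x, (f x + t * g x) ^ 2 = t * t * g x ^ 2 + 2 * t * (f x * g x) + f x ^ 2 :=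
      fun x => by ring
    simp_rw [hexp] at h
    have h1 : ContinuousOn (fun x => t * t * g x ^ 2) (Set.uIcc a b) := by fun_prop
    have h2 : ContinuousOn (fun x => 2 * t * (f x * g x)) (Set.uIcc a b) := by fun_prop
    have h12 : ContinuousOn (fun x => t * t * g x ^ 2 + 2 * t * (f x * g x)) (Set.uIcc a b) :=
      h1.add h2
    have h3 : ContinuousOn (fun x => f x ^ 2) (Set.uIcc a b) := by fun_prop
    rw [intervalIntegral.integral_add h12.intervalIntegrable h3.intervalIntegrable,
      intervalIntegral.integral_add h1.intervalIntegrable h2.intervalIntegrable,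
      intervalIntegral.integral_const_mul, intervalIntegral.integral_const_mul] at h
    linarith
  have hdisc := discrim_le_zero hquad
  rw [discrim] at hdisc
  rw [← Real.sqrt_mul hf2]
  exact Real.abs_le_sqrt (by linarith)

theorem flCoeff_le_second_deriv (v : ℝ → ℝ)
    (hv : ContDiffOn ℝ 2 v (Set.Icc (-1) 1)) (n : ℕ) (hn : 2 ≤ n) :
    |flCoeff v n| ≤
      4 * Real.sqrt 2 * L2norm (iteratedDerivWithin 2 v (Set.Icc (-1) 1)) /
        (2 * (n : ℝ) - 3) ^ ((3 : ℝ) / 2) := by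
  obtain ⟨k, rfl⟩ := Nat.exists_eq_add_of_le' hn
  set I : Set ℝ := Set.Icc (-1) 1 with hI
  have huniq : UniqueDiffOn ℝ I := uniqueDiffOn_Icc (by norm_num)
  have hv' : ContDiffOn ℝ 1 (derivWithin v I) I := hv.derivWithin huniq (by norm_num)
  have hiter : iteratedDerivWithin 2 v I = derivWithin (derivWithin v I) I := by
    rw [iteratedDerivWithin_succ', iteratedDerivWithin_one]
  rw [hiter]
  set w := derivWithin (derivWithin v I) I with hw
  have hwcont : ContinuousOn w I := hv'.continuousOn_derivWithin huniq le_rfl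
  set c : ℝ := 2 ^ (k + 2) * ((k + 2).factorial : ℝ) with hc
  have hcpos : 0 < c := by positivity
  set J := ∫ x in (-1 : ℝ)..1, w x * (rodriguesDeriv (k + 2) k).eval x with hJ
  have hcoeff : flCoeff v (k + 2) = (2 * k + 5) / (2 * c) * J := by
    have hint : ∫ x in (-1 : ℝ)..1, v x * legendreP (k + 2) x = 1 / c * J := by
      rw [hJ, ← integral_mul_rodriguesDeriv
        (fun x hx => (hv.differentiableOn (by norm_num) x hx).hasDerivWithinAt)
        (fun x hx => (hv'.differentiableOn (by norm_num) x hx).hasDerivWithinAt) hwcont,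
        ← intervalIntegral.integral_const_mul]
      refine intervalIntegral.integral_congr fun x _ => ?_
      simp only [legendreP_eq_rodriguesDeriv]
      ring
    rw [flCoeff, hint]
    push_cast
    field_simp
    ring
  have hIu : Set.uIcc (-1 : ℝ) 1 = I := Set.uIcc_of_le (by norm_num)
  have hCS : |J| ≤ L2norm w * √(∫ x in (-1 : ℝ)..1, (rodriguesDeriv (k + 2) k).eval x ^ 2) :=
    abs_integral_mul_le_sqrt_mul_sqrt (by norm_num) (hIu ▸ hwcont)
      (Polynomial.continuous _).continuousOn
  set q := ∫ x in (-1 : ℝ)..1, (rodriguesDeriv (k + 2) k).eval x ^ 2 with hq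
  have hq0 : 0 ≤ q := intervalIntegral.integral_nonneg (by norm_num) fun x _ => sq_nonneg _
  have hqle := integral_rodriguesDeriv_sub_two_sq_le k
  rw [← hq, ← hc] at hqle
  have hbase : 2 * ((k + 2 : ℕ) : ℝ) - 3 = 2 * k + 1 := by
    push_cast
    ring
  have hpow : (2 * (k : ℝ) + 1) ^ ((3 : ℝ) / 2) = √((2 * (k : ℝ) + 1) ^ 3) := by
    rw [Real.sqrt_eq_rpow, ← Real.rpow_natCast, ← Real.rpow_mul (by positivity)]
    norm_num
  have hconst : (2 * k + 5) / (2 * c) * √q * √((2 * (k : ℝ) + 1) ^ 3) ≤ 4 * √2 := by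
    refine le_of_sq_le_sq ?_ (by positivity)
    rw [mul_pow, mul_pow, mul_pow, Real.sq_sqrt hq0, Real.sq_sqrt (by positivity),
      Real.sq_sqrt (by norm_num)]
    calc ((2 * k + 5) / (2 * c)) ^ 2 * q * (2 * (k : ℝ) + 1) ^ 3
        ≤ ((2 * k + 5) / (2 * c)) ^ 2 * (2 * c ^ 2 /
          ((2 * k + 5) * ((k + 1) * (k + 2) * (k + 3) * (k + 4)))) * (2 * (k : ℝ) + 1) ^ 3 := by
          gcongr
      _ = (2 * k + 5) * (2 * (k : ℝ) + 1) ^ 3 /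
          (2 * ((k + 1) * (k + 2) * (k + 3) * (k + 4))) := by
          field_simp
      _ ≤ 4 ^ 2 * 2 := by
          rw [div_le_iff₀ (by positivity)]
          have : (0 : ℝ) ≤ k := k.cast_nonneg
          rw [← sub_nonneg]
          ring_nf
          positivity
  rw [hbase, hpow, le_div_iff₀ (by positivity), hcoeff, abs_mul,
    abs_of_nonneg (by positivity : 0 ≤ (2 * (k : ℝ) + 5) / (2 * c))]
  have hL : 0 ≤ L2norm w := Real.sqrt_nonneg _
  calc (2 * k + 5) / (2 * c) * |J| * √((2 * (k : ℝ) + 1) ^ 3)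
      ≤ (2 * k + 5) / (2 * c) * (L2norm w * √q) * √((2 * (k : ℝ) + 1) ^ 3) := by gcongr
    _ = (2 * k + 5) / (2 * c) * √q * √((2 * (k : ℝ) + 1) ^ 3) * L2norm w := by ring
    _ ≤ 4 * √2 * L2norm w := by gcongr
end

section
/- There exists a constant C > 0 such that for every four times continuously differentiable function v : [−1,1] → ℝ and every integer n ≥ 4, the n-th Fourier–Legendre coefficient of v satisfies |v_n| ≤ C · ‖v⁽⁴⁾‖ / (2n − 7)^{7/2}. -/
open MeasureTheory

open Polynomial

/-- The normalised polynomial `(x² - 1)ⁿ / (2ⁿ n!)` of Rodrigues' formula. -/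
noncomputable def rodriguesPoly (n : ℕ) : ℝ[X] :=
  C (1 / (2 ^ n * (Nat.factorial n : ℝ))) * (X ^ 2 - 1) ^ n

/-- The `n`-th Legendre polynomial as a formal polynomial. -/
noncomputable def legendrePoly (n : ℕ) : ℝ[X] := derivative^[n] (rodriguesPoly n)

theorem Polynomial.iteratedDeriv_eval (p : ℝ[X]) (n : ℕ) :
    iteratedDeriv n (fun x => p.eval x) = fun x => (derivative^[n] p).eval x := by
  induction n with
  | zero => simp
  | succ n ih =>
    rw [iteratedDeriv_succ, ih, Function.iterate_succ_apply']
    ext x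
    exact Polynomial.deriv _

theorem legendreP_eq_eval (n : ℕ) (x : ℝ) : legendreP n x = (legendrePoly n).eval x := by
  have h : (fun y : ℝ => (y ^ 2 - 1) ^ n) = fun y => ((X ^ 2 - 1 : ℝ[X]) ^ n).eval y := by
    ext y; simp
  rw [legendreP, h, Polynomial.iteratedDeriv_eval, legendrePoly, rodriguesPoly,
    iterate_derivative_C_mul, eval_mul, eval_C]

theorem mul_rodriguesPoly (n : ℕ) :
    (X ^ 2 - 1) * rodriguesPoly n = C (2 * ((n : ℝ) + 1)) * rodriguesPoly (n + 1) := by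
  have h : 1 / (2 ^ n * (Nat.factorial n : ℝ)) =
      2 * ((n : ℝ) + 1) * (1 / (2 ^ (n + 1) * (Nat.factorial (n + 1) : ℝ))) := by
    rw [Nat.factorial_succ]
    push_cast
    field_simp
    ring
  rw [rodriguesPoly, rodriguesPoly, h, C_mul, pow_succ]
  ring

theorem derivative_rodriguesPoly_succ (n : ℕ) :
    derivative (rodriguesPoly (n + 1)) = X * rodriguesPoly n := by
  have h : 1 / (2 ^ n * (Nat.factorial n : ℝ)) =
      1 / (2 ^ (n + 1) * (Nat.factorial (n + 1) : ℝ)) * ((n : ℝ) + 1) * 2 := by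
    rw [Nat.factorial_succ]
    push_cast
    field_simp
    ring
  rw [rodriguesPoly, rodriguesPoly, derivative_C_mul, derivative_pow, h, C_mul, C_mul,
    C_ofNat]
  simp
  ring

theorem derivative_derivative_rodriguesPoly (n : ℕ) :
    derivative (derivative (rodriguesPoly (n + 2))) =
      C (2 * (n : ℝ) + 3) * rodriguesPoly (n + 1) + rodriguesPoly n := by
  have h : C (2 * (n : ℝ) + 3) = 1 + C (2 * ((n : ℝ) + 1)) := by
    rw [← C_1, ← C_add]
    congr 1
    ring
  rw [derivative_rodriguesPoly_succ, derivative_mul, derivative_X, derivative_rodriguesPoly_succ, h,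
    add_mul, ← mul_rodriguesPoly]
  ring

theorem legendrePoly_succ (n : ℕ) :
    legendrePoly (n + 1) = X * legendrePoly n + n • derivative^[n - 1] (rodriguesPoly n) := by
  rw [legendrePoly, Function.iterate_succ_apply, derivative_rodriguesPoly_succ, mul_comm X,
    iterate_derivative_mul_X, legendrePoly, mul_comm X]

theorem derivative_legendrePoly_succ (n : ℕ) :
    derivative (legendrePoly (n + 1)) =
      X * derivative (legendrePoly n) + C ((n : ℝ) + 1) * legendrePoly n := by
  rw [legendrePoly, ← Function.iterate_succ_apply' derivative, Function.iterate_succ_apply,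
    derivative_rodriguesPoly_succ, mul_comm X, iterate_derivative_mul_X, legendrePoly,
    Function.iterate_succ_apply']
  simp
  ring

theorem legendrePoly_add_two (n : ℕ) :
    legendrePoly (n + 2) =
      C (2 * (n : ℝ) + 3) * derivative^[n] (rodriguesPoly (n + 1)) + legendrePoly n := by
  rw [legendrePoly, Function.iterate_succ_apply, Function.iterate_succ_apply,
    derivative_derivative_rodriguesPoly, iterate_map_add, iterate_derivative_C_mul,
    legendrePoly]

theorem derivative_legendrePoly_add_two (n : ℕ) :
    derivative (legendrePoly (n + 2)) =
      C (2 * (n : ℝ) + 3) * legendrePoly (n + 1) + derivative (legendrePoly n) := by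
  rw [legendrePoly_add_two, derivative_add, derivative_C_mul,
    ← Function.iterate_succ_apply' derivative, ← legendrePoly]

theorem X_mul_derivative_legendrePoly_succ (n : ℕ) :
    X * derivative (legendrePoly (n + 1)) =
      C ((n : ℝ) + 1) * legendrePoly (n + 1) + derivative (legendrePoly n) := by
  have h1 := derivative_legendrePoly_succ (n + 1)
  rw [derivative_legendrePoly_add_two] at h1
  have h : C (2 * (n : ℝ) + 3) = C ((n : ℝ) + 1) + C (((n + 1 : ℕ) : ℝ) + 1) := by
    rw [← C_add]
    congr 1
    push_cast
    ring
  rw [h] at h1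
  linear_combination -h1

theorem eval_iterate_derivative_rodriguesPoly {k n : ℕ} (hk : k < n) {x : ℝ} (hx : x ^ 2 = 1) :
    (derivative^[k] (rodriguesPoly n)).eval x = 0 := by
  have h : (X ^ 2 - 1 : ℝ[X]) ∣ derivative^[k] (rodriguesPoly n) :=
    (dvd_pow_self _ (Nat.sub_ne_zero_of_lt hk)).trans
      (pow_sub_dvd_iterate_derivative_of_pow_dvd k (Dvd.intro_left _ rfl))
  obtain ⟨q, hq⟩ := h
  simp [hq, hx]

theorem eval_legendrePoly_sq (n : ℕ) {x : ℝ} (hx : x ^ 2 = 1) :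
    (legendrePoly n).eval x ^ 2 = 1 := by
  induction n with
  | zero => simp [legendrePoly, rodriguesPoly]
  | succ n ih =>
    have h : (n • derivative^[n - 1] (rodriguesPoly n)).eval x = 0 := by
      rcases Nat.eq_zero_or_pos n with rfl | hn
      · simp
      · rw [eval_smul, eval_iterate_derivative_rodriguesPoly (by omega) hx, smul_zero]
    rw [legendrePoly_succ, eval_add, h, eval_mul, eval_X, add_zero, mul_pow, hx, ih, one_mul]

theorem intervalIntegrable_mul_eval {f : ℝ → ℝ} (hf : ContinuousOn f (Set.Icc (-1) 1)) (p : ℝ[X]) :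
    IntervalIntegrable (fun x => f x * p.eval x) volume (-1) 1 :=
  (hf.mul p.continuousOn).intervalIntegrable_of_Icc (by norm_num)

/-- Integration by parts expresses the Legendre moments of `f` through those of `f'`. -/
theorem integral_mul_legendrePoly_succ {f f' : ℝ → ℝ}
    (hf : ∀ x ∈ Set.Icc (-1 : ℝ) 1, HasDerivWithinAt f (f' x) (Set.Icc (-1) 1) x)
    (hf' : ContinuousOn f' (Set.Icc (-1) 1)) (n : ℕ) :
    (2 * (n : ℝ) + 3) * ∫ x in (-1 : ℝ)..1, f x * (legendrePoly (n + 1)).eval x =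
      (∫ x in (-1 : ℝ)..1, f' x * (legendrePoly n).eval x) -
        ∫ x in (-1 : ℝ)..1, f' x * (legendrePoly (n + 2)).eval x := by
  have hI : Set.uIcc (-1 : ℝ) 1 = Set.Icc (-1) 1 := Set.uIcc_of_le (by norm_num)
  have key := intervalIntegral.integral_mul_deriv_eq_deriv_mul_of_hasDerivWithinAt
    (a := -1) (b := 1) (u := f) (u' := f')
    (v := fun x => (legendrePoly (n + 2) - legendrePoly n).eval x)
    (v' := fun x => (derivative (legendrePoly (n + 2) - legendrePoly n)).eval x)
    (by rwa [hI]) (fun x _ => (Polynomial.hasDerivAt _ x).hasDerivWithinAt)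
    (hf'.intervalIntegrable_of_Icc (by norm_num))
    ((Polynomial.continuous _).intervalIntegrable _ _)
  have hd : derivative (legendrePoly (n + 2) - legendrePoly n) =
      C (2 * (n : ℝ) + 3) * legendrePoly (n + 1) := by
    rw [derivative_sub, derivative_legendrePoly_add_two, add_sub_cancel_right]
  have hb : ∀ x : ℝ, x ^ 2 = 1 → (legendrePoly (n + 2) - legendrePoly n).eval x = 0 := by
    intro x hx
    rw [legendrePoly_add_two, add_sub_cancel_right, eval_mul,
      eval_iterate_derivative_rodriguesPoly (Nat.lt_succ_self n) hx, mul_zero]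
  rw [hd, hb 1 (by norm_num), hb (-1) (by norm_num)] at key
  simp only [eval_mul, eval_C, eval_sub, mul_sub, mul_left_comm (f _) (_ + _), mul_zero,
    sub_zero, zero_sub] at key
  rw [intervalIntegral.integral_const_mul, intervalIntegral.integral_sub
    (intervalIntegrable_mul_eval hf' _) (intervalIntegrable_mul_eval hf' _)] at key
  linarith

theorem integral_mul_legendrePoly_eq_zero {k n : ℕ} (hk : k ≤ n) {p : ℝ[X]}
    (hp : derivative^[k] p = 0) :
    ∫ x in (-1 : ℝ)..1, p.eval x * (legendrePoly n).eval x = 0 := by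
  induction k generalizing n p with
  | zero =>
    obtain rfl : p = 0 := hp
    simp
  | succ k ih =>
    obtain ⟨n, rfl⟩ : ∃ m, n = m + 1 := ⟨n - 1, by omega⟩
    rw [Function.iterate_succ_apply] at hp
    have h := integral_mul_legendrePoly_succ (f := fun x => p.eval x)
      (fun x _ => (p.hasDerivAt x).hasDerivWithinAt) (derivative p).continuousOn n
    rw [ih (by omega) hp, ih (by omega) hp, sub_zero] at h
    exact (mul_eq_zero.mp h).resolve_left (by positivity)

theorem iterate_derivative_legendrePoly_succ_eq_zero (n : ℕ) :
    derivative^[n + 1] (legendrePoly n) = 0 := by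
  rw [legendrePoly, ← Function.iterate_add_apply]
  refine iterate_derivative_eq_zero (lt_of_le_of_lt (natDegree_C_mul_le _ _) ?_)
  have h : (X ^ 2 - 1 : ℝ[X]).natDegree ≤ 2 := by compute_degree
  calc ((X ^ 2 - 1 : ℝ[X]) ^ n).natDegree ≤ n * 2 := natDegree_pow_le_of_le n h
    _ < n + 1 + n := by omega

theorem integral_legendrePoly_sq (n : ℕ) :
    ∫ x in (-1 : ℝ)..1, (legendrePoly n).eval x ^ 2 = 2 / (2 * (n : ℝ) + 1) := by
  rcases n with _ | n
  · norm_num [legendrePoly, rodriguesPoly]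
  set P := legendrePoly (n + 1) with hP
  have key := intervalIntegral.integral_mul_deriv_eq_deriv_mul
    (a := -1) (b := 1) (u := fun x => (P ^ 2).eval x)
    (u' := fun x => (derivative (P ^ 2)).eval x) (v := fun x => x) (v' := fun _ => 1)
    (fun x _ => Polynomial.hasDerivAt _ x) (fun x _ => hasDerivAt_id x)
    ((Polynomial.continuous _).intervalIntegrable _ _) (by simp)
  have hd (x : ℝ) : (derivative (P ^ 2)).eval x * x =
      2 * ((n : ℝ) + 1) * P.eval x ^ 2 + 2 * ((derivative (legendrePoly n)).eval x * P.eval x) := by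
    have h := congrArg (fun q => eval x q) (X_mul_derivative_legendrePoly_succ n)
    simp only [eval_mul, eval_add, eval_X, eval_C, ← hP] at h
    simp only [derivative_pow, eval_mul, eval_pow, eval_C]
    norm_num
    linear_combination 2 * P.eval x * h
  have horth : ∫ x in (-1 : ℝ)..1, (derivative (legendrePoly n)).eval x * P.eval x = 0 :=
    integral_mul_legendrePoly_eq_zero (Nat.le_succ n)
      (by rw [← Function.iterate_succ_apply, iterate_derivative_legendrePoly_succ_eq_zero])
  simp only [hd, eval_pow, mul_one] at key
  rw [intervalIntegral.integral_add (Continuous.intervalIntegrable (by fun_prop) _ _)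
    (Continuous.intervalIntegrable (by fun_prop) _ _), intervalIntegral.integral_const_mul,
    intervalIntegral.integral_const_mul, horth, eval_legendrePoly_sq _ (by norm_num),
    eval_legendrePoly_sq _ (by norm_num)] at key
  rw [eq_div_iff (by positivity)]
  push_cast
  linarith

/-- The Cauchy–Schwarz inequality for continuous functions on `[-1, 1]`. -/
theorem abs_integral_mul_le_L2norm {f g : ℝ → ℝ} (hf : ContinuousOn f (Set.Icc (-1) 1))
    (hg : ContinuousOn g (Set.Icc (-1) 1)) :
    |∫ x in (-1 : ℝ)..1, f x * g x| ≤ L2norm f * L2norm g := by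
  have hle : (-1 : ℝ) ≤ 1 := by norm_num
  have hff : IntervalIntegrable (fun x => f x ^ 2) volume (-1) 1 :=
    (hf.pow 2).intervalIntegrable_of_Icc hle
  have hgg : IntervalIntegrable (fun x => g x ^ 2) volume (-1) 1 :=
    (hg.pow 2).intervalIntegrable_of_Icc hle
  have hfg : IntervalIntegrable (fun x => f x * g x) volume (-1) 1 :=
    (hf.mul hg).intervalIntegrable_of_Icc hle
  have hdisc := discrim_le_zero (a := ∫ x in (-1 : ℝ)..1, g x ^ 2)
    (b := 2 * ∫ x in (-1 : ℝ)..1, f x * g x) (c := ∫ x in (-1 : ℝ)..1, f x ^ 2) fun t => by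
      have h0 : 0 ≤ ∫ x in (-1 : ℝ)..1, (t * g x + f x) ^ 2 :=
        intervalIntegral.integral_nonneg hle fun x _ => sq_nonneg _
      have h1 : ∫ x in (-1 : ℝ)..1, (t * g x + f x) ^ 2 =
          ∫ x in (-1 : ℝ)..1, (t ^ 2 * g x ^ 2 + 2 * t * (f x * g x)) + f x ^ 2 := by
        congr 1
        ext x
        ring
      rw [h1, intervalIntegral.integral_add ((hgg.const_mul _).add (hfg.const_mul _)) hff,
        intervalIntegral.integral_add (hgg.const_mul _) (hfg.const_mul _),
        intervalIntegral.integral_const_mul, intervalIntegral.integral_const_mul] at h0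
      linarith
  rw [L2norm, L2norm, ← Real.sqrt_mul (intervalIntegral.integral_nonneg hle fun x _ => sq_nonneg _)]
  apply Real.abs_le_sqrt
  rw [discrim] at hdisc
  linarith

theorem abs_integral_mul_legendrePoly_le {f : ℝ → ℝ} (hf : ContinuousOn f (Set.Icc (-1) 1))
    {m n : ℕ} (hmn : m ≤ n) :
    |∫ x in (-1 : ℝ)..1, f x * (legendrePoly n).eval x| ≤
      L2norm f * √(2 / (2 * (m : ℝ) + 1)) := by
  refine (abs_integral_mul_le_L2norm hf (legendrePoly n).continuousOn).trans ?_
  rw [L2norm, L2norm, integral_legendrePoly_sq]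
  gcongr

theorem abs_integral_mul_legendrePoly_le_of_deriv {f f' : ℝ → ℝ}
    (hf : ∀ x ∈ Set.Icc (-1 : ℝ) 1, HasDerivWithinAt f (f' x) (Set.Icc (-1) 1) x)
    (hf' : ContinuousOn f' (Set.Icc (-1) 1)) {d K : ℝ} (hd : 0 < d) {m : ℕ}
    (hdm : d ≤ 2 * (m : ℝ) + 1)
    (hK : ∀ n, m ≤ n → |∫ x in (-1 : ℝ)..1, f' x * (legendrePoly n).eval x| ≤ K)
    {n : ℕ} (hn : m + 1 ≤ n) :
    |∫ x in (-1 : ℝ)..1, f x * (legendrePoly n).eval x| ≤ 2 * K / d := by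
  obtain ⟨n, rfl⟩ : ∃ k, n = k + 1 := ⟨n - 1, by omega⟩
  have hmn : (m : ℝ) ≤ n := by exact_mod_cast Nat.le_of_succ_le_succ hn
  have h := congrArg abs (integral_mul_legendrePoly_succ hf hf' n)
  rw [abs_mul, abs_of_pos (by positivity)] at h
  rw [le_div_iff₀ hd]
  calc _ ≤ |∫ x in (-1 : ℝ)..1, f x * (legendrePoly (n + 1)).eval x| * (2 * (n : ℝ) + 3) := by
        gcongr
        linarith
    _ ≤ K + K := by
        rw [mul_comm, h]
        exact (abs_sub _ _).trans (add_le_add (hK n (by omega)) (hK (n + 2) (by omega)))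
    _ = 2 * K := by ring

/-- Iterating integration by parts `k` times bounds the Legendre moments of `v` by the `L²` norm
of its `k`-th derivative. -/
theorem abs_integral_mul_legendrePoly_le_iteratedDerivWithin {v : ℝ → ℝ} {k : ℕ}
    (hv : ContDiffOn ℝ k v (Set.Icc (-1) 1)) (m : ℕ) {j : ℕ} (hj : j ≤ k) {n : ℕ}
    (hn : m + j ≤ n) :
    |∫ x in (-1 : ℝ)..1, iteratedDerivWithin (k - j) v (Set.Icc (-1) 1) x *
        (legendrePoly n).eval x| ≤
      2 ^ j * (L2norm (iteratedDerivWithin k v (Set.Icc (-1) 1)) * √(2 / (2 * (m : ℝ) + 1))) /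
        (2 * (m : ℝ) + 1) ^ j := by
  have hs : UniqueDiffOn ℝ (Set.Icc (-1 : ℝ) 1) := uniqueDiffOn_Icc (by norm_num)
  induction j generalizing n with
  | zero =>
    simpa using abs_integral_mul_legendrePoly_le
      (hv.continuousOn_iteratedDerivWithin le_rfl hs) hn
  | succ j ih =>
    have hkj : k - j = k - (j + 1) + 1 := by omega
    refine (abs_integral_mul_legendrePoly_le_of_deriv (d := 2 * (m : ℝ) + 1) (m := m + j)
      (f' := iteratedDerivWithin (k - j) v (Set.Icc (-1) 1)) ?_ ?_ (by positivity) ?_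
      (fun i hi => ih (by omega) hi) hn).trans_eq ?_
    · intro x hx
      rw [hkj, iteratedDerivWithin_succ]
      exact (hv.differentiableOn_iteratedDerivWithin (by exact_mod_cast (by omega)) hs x
        hx).hasDerivWithinAt
    · exact hv.continuousOn_iteratedDerivWithin (by exact_mod_cast Nat.sub_le k j) hs
    · push_cast
      linarith [(Nat.cast_nonneg j : (0 : ℝ) ≤ j)]
    · field_simp
      ring

theorem flCoeff_le_fourth_deriv :
    ∃ C : ℝ, 0 < C ∧ ∀ v : ℝ → ℝ, ContDiffOn ℝ 4 v (Set.Icc (-1) 1) → ∀ n : ℕ, 4 ≤ n →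
      |flCoeff v n| ≤
        C * L2norm (iteratedDerivWithin 4 v (Set.Icc (-1) 1)) /
          (2 * (n : ℝ) - 7) ^ ((7 : ℝ) / 2) := by
  refine ⟨72 * √2, by positivity, fun v hv n hn => ?_⟩
  obtain ⟨m, rfl⟩ : ∃ m, n = m + 4 := ⟨n - 4, by omega⟩
  have h := abs_integral_mul_legendrePoly_le_iteratedDerivWithin (k := 4)
    (by exact_mod_cast hv) m le_rfl le_rfl
  simp only [Nat.sub_self, iteratedDerivWithin_zero] at h
  set M := L2norm (iteratedDerivWithin 4 v (Set.Icc (-1) 1))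
  have hM : 0 ≤ M := Real.sqrt_nonneg _
  set d : ℝ := 2 * (m : ℝ) + 1 with hd
  have hm : (0 : ℝ) ≤ m := Nat.cast_nonneg m
  have hd1 : 1 ≤ d := by linarith
  have hd0 : 0 < d := by linarith
  have hn7 : 2 * ((m + 4 : ℕ) : ℝ) - 7 = d := by push_cast; rw [hd]; ring
  have hpow : d ^ ((7 : ℝ) / 2) = d ^ 3 * √d := by
    rw [Real.sqrt_eq_rpow, ← Real.rpow_natCast, ← Real.rpow_add hd0]
    norm_num
  have hcoef : (2 * ((m + 4 : ℕ) : ℝ) + 1) / 2 ≤ 9 / 2 * d := by push_cast; linarith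
  rw [hn7, hpow, flCoeff, abs_mul, abs_of_nonneg (by positivity)]
  simp only [legendreP_eq_eval]
  calc _ ≤ 9 / 2 * d * (2 ^ 4 * (M * √(2 / d)) / d ^ 4) := by gcongr
    _ = 72 * √2 * M / (d ^ 3 * √d) := by
        rw [Real.sqrt_div (by norm_num)]
        have := Real.sqrt_pos.mpr hd0
        field_simp
        ring
end
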